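/- Let G=K_n be the complete graph, fix ε∈(0,1/2) and β>0, and let A⊆V with |A|=⌈n^{1/2+ε}⌉. Consider the A-corrupted Glauber dynamics started from i.i.d. uniform ±1 spins on V∖A, with the following adversary strategy: the spins of A are initially all +1; whenever M_t, the sum of the spins over V∖A, reaches n^{1/2+ε/2} the adversary sets all spins of A to −1, and whenever M_t reaches −n^{1/2+ε/2} it sets them all to +1. Then for all n sufficiently large and every T, with probability at least (1−e^{−n^ε/2})·(1−e^{−βn})^T, the uncorrupted magnetization satisfies |M_t| ≤ (1/2)n^{1/2+ε} for all t ≤ T, so the total magnetization keeps fluctuating between −√n and √n and the dynamics does not converge to a phase within T steps. -/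

import Mathlib

open Real Finset
open scoped Classical

noncomputable section

variable {n : ℕ}

/-- The real value of a spin: `true ↦ +1`, `false ↦ -1`. -/
def spinVal (b : Bool) : ℝ := if b then 1 else -1

/-- Sum of the spins of the neighbors of `v` in the complete graph `K_n`. -/
def nbrSumK (σ : Fin n → Bool) (v : Fin n) : ℝ :=
  ∑ u : Fin n, if u ≠ v then spinVal (σ u) else 0

/-- Glauber probability (on `K_n`) of updating `v` to `+1`. -/
def glauberPK (β : ℝ) (σ : Fin n → Bool) (v : Fin n) : ℝ :=
  exp (β * nbrSumK σ v) / (exp (β * nbrSumK σ v) + exp (-(β * nbrSumK σ v)))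

/-- Magnetization of the uncorrupted vertices: `M(σ) = ∑_{v ∉ A} σ(v)`. -/
def mag (A : Finset (Fin n)) (σ : Fin n → Bool) : ℝ :=
  ∑ v ∈ Aᶜ, spinVal (σ v)

/-- The adversary's current sign (`true` = `+1`) as a function of the trajectory so far:
initially `+1`; it becomes `−1` whenever the uncorrupted magnetization reaches `thr`,
and `+1` whenever it reaches `−thr`. -/
def advSign (A : Finset (Fin n)) (thr : ℝ) :
    (t : ℕ) → (Fin (t+1) → (Fin n → Bool)) → Bool
  | 0, h =>
      if thr ≤ mag A (h 0) then false
      else true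
  | t+1, h =>
      if thr ≤ mag A (h (Fin.last (t+1))) then false
      else if mag A (h (Fin.last (t+1))) ≤ -thr then true
      else advSign A thr t (fun i => h i.castSucc)

/-- One-step kernel of the corrupted dynamics on `K_n` with this adversary: a uniformly
random vertex `v` is chosen; if `v ∉ A` it gets the usual Glauber update; in every step
the adversary sets all the spins on `A` to its current sign. -/
def polarK (β : ℝ) (A : Finset (Fin n)) (thr : ℝ)
    (t : ℕ) (h : Fin (t+1) → (Fin n → Bool)) (σ' : Fin n → Bool) : ℝ :=
  (n : ℝ)⁻¹ * ∑ v : Fin n,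
    if v ∈ A then
      (if σ' = (fun u => if u ∈ A then advSign A thr t h else h (Fin.last t) u)
        then 1 else 0)
    else
      (if σ' = (fun u => if u ∈ A then advSign A thr t h
                 else Function.update (h (Fin.last t)) v true u)
        then glauberPK β (h (Fin.last t)) v else 0)
      + (if σ' = (fun u => if u ∈ A then advSign A thr t h
                 else Function.update (h (Fin.last t)) v false u)
        then 1 - glauberPK β (h (Fin.last t)) v else 0)

/-- Initial distribution: i.i.d. uniform `±1` spins on `V ∖ A`, all spins on `A` set to `+1`. -/
def initIID (A : Finset (Fin n)) (σ : Fin n → Bool) : ℝ :=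
  if (∀ v ∈ A, σ v = true) then (1/2) ^ (n - A.card) else 0

/-- Probability of a trajectory `h` of length `t+1` with initial distribution `initP`
and history-dependent kernel `K`. -/
def trajD (initP : (Fin n → Bool) → ℝ)
    (K : (t : ℕ) → (Fin (t+1) → (Fin n → Bool)) → (Fin n → Bool) → ℝ) :
    (t : ℕ) → (Fin (t+1) → (Fin n → Bool)) → ℝ
  | 0, h => initP (h 0)
  | t+1, h => trajD initP K t (fun i => h i.castSucc) *
      K t (fun i => h i.castSucc) (h (Fin.last (t+1)))

def gpot (lam m M : ℝ) : ℝ := exp (lam * (|M| - m))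

def InvP (A : Finset (Fin n)) (m : ℝ) (σ : Fin n → Bool) : Prop :=
  ∀ b : Bool, m / 2 < spinVal b * mag A σ → ∀ u ∈ A, σ u = !b

def Fpot (A : Finset (Fin n)) (lam m : ℝ) (σ : Fin n → Bool) : ℝ :=
  if InvP A m σ then 1 - gpot lam m (mag A σ) else 0

lemma spinVal_cases (b : Bool) : spinVal b = 1 ∨ spinVal b = -1 := by
  cases b <;> simp [spinVal]

lemma spinVal_not (b : Bool) : spinVal (!b) = -spinVal b := by
  cases b <;> simp [spinVal]

lemma glauber_nonneg (β : ℝ) (σ : Fin n → Bool) (v : Fin n) : 0 ≤ glauberPK β σ v := by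
  unfold glauberPK; positivity

lemma glauber_le_one (β : ℝ) (σ : Fin n → Bool) (v : Fin n) : glauberPK β σ v ≤ 1 := by
  unfold glauberPK
  rw [div_le_one (by positivity)]
  linarith [exp_pos (-(β * nbrSumK σ v))]

/-- probability of updating to `b` -/
def glB (β : ℝ) (σ : Fin n → Bool) (v : Fin n) (b : Bool) : ℝ :=
  if b then glauberPK β σ v else 1 - glauberPK β σ v

lemma glB_le (β : ℝ) (σ : Fin n → Bool) (v : Fin n) (b : Bool) :
    glB β σ v b ≤ exp (2 * (β * (spinVal b * nbrSumK σ v))) := by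
  have key : ∀ x : ℝ, exp x / (exp x + exp (-x)) ≤ exp (2 * x) := by
    intro x
    rw [div_le_iff₀ (by positivity), mul_add, ← exp_add, ← exp_add]
    have : 2 * x + -x = x := by ring
    rw [this]
    linarith [exp_pos (2 * x + x)]
  cases b
  · have h1 : glB β σ v false = exp (-(β * nbrSumK σ v)) /
        (exp (-(β * nbrSumK σ v)) + exp (- -(β * nbrSumK σ v))) := by
      simp only [glB, glauberPK, neg_neg, Bool.false_eq_true, if_false]
      have := exp_pos (-(β * nbrSumK σ v))
      have := exp_pos ((β * nbrSumK σ v))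
      rw [eq_div_iff (by positivity), sub_mul, add_comm (exp (-(β * nbrSumK σ v))),
        div_mul_cancel₀ _ (by positivity)]
      ring
    rw [h1]
    refine (key _).trans (le_of_eq ?_)
    simp [spinVal]
  · simpa [glB, glauberPK, spinVal] using key (β * nbrSumK σ v)

lemma polarK_nonneg (β : ℝ) (A : Finset (Fin n)) (thr : ℝ) (t : ℕ)
    (h : Fin (t+1) → (Fin n → Bool)) (σ' : Fin n → Bool) : 0 ≤ polarK β A thr t h σ' := by
  unfold polarK
  refine mul_nonneg (by positivity) (Finset.sum_nonneg fun v _ => ?_)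
  have h1 := glauber_nonneg β (h (Fin.last t)) v
  have h2 := glauber_le_one β (h (Fin.last t)) v
  have h3 : 0 ≤ 1 - glauberPK β (h (Fin.last t)) v := by linarith
  split_ifs <;> linarith

def nxt (A : Finset (Fin n)) (s : Bool) (τ : Fin n → Bool) : Fin n → Bool :=
  fun u => if u ∈ A then s else τ u

lemma step_sum (β : ℝ) (A : Finset (Fin n)) (thr : ℝ) (t : ℕ)
    (h : Fin (t+1) → (Fin n → Bool)) (F : (Fin n → Bool) → ℝ) :
    ∑ σ', polarK β A thr t h σ' * F σ' = (n : ℝ)⁻¹ * ∑ v : Fin n,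
      if v ∈ A then F (nxt A (advSign A thr t h) (h (Fin.last t)))
      else glauberPK β (h (Fin.last t)) v *
          F (nxt A (advSign A thr t h) (Function.update (h (Fin.last t)) v true))
        + (1 - glauberPK β (h (Fin.last t)) v) *
          F (nxt A (advSign A thr t h) (Function.update (h (Fin.last t)) v false)) := by
  unfold polarK
  simp only [mul_assoc, Finset.sum_mul]
  rw [← Finset.mul_sum, Finset.sum_comm]
  congr 1
  refine Finset.sum_congr rfl fun v _ => ?_
  by_cases hv : v ∈ A
  · simp only [hv, if_true]
    simp
    rfl
  · simp only [hv, if_false]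
    simp [add_mul, Finset.sum_add_distrib]
    rfl

lemma mag_nxt (A : Finset (Fin n)) (s : Bool) (τ : Fin n → Bool) :
    mag A (nxt A s τ) = mag A τ := by
  unfold mag
  refine Finset.sum_congr rfl fun v hv => ?_
  simp at hv
  simp [nxt, hv]

lemma mag_update (A : Finset (Fin n)) (τ : Fin n → Bool) (v : Fin n) (hv : v ∉ A) (b : Bool) :
    mag A (Function.update τ v b) = mag A τ + (spinVal b - spinVal (τ v)) := by
  unfold mag
  have hv' : v ∈ Aᶜ := by simpa using hv
  rw [← Finset.add_sum_erase _ _ hv', ← Finset.add_sum_erase Aᶜ (fun v => spinVal (τ v)) hv']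
  have : ∑ x ∈ Aᶜ.erase v, spinVal (Function.update τ v b x) = ∑ x ∈ Aᶜ.erase v, spinVal (τ x) := by
    refine Finset.sum_congr rfl fun u hu => ?_
    rw [Function.update_of_ne (Finset.ne_of_mem_erase hu)]
  rw [this]; simp; ring

lemma mag_close (A : Finset (Fin n)) (τ : Fin n → Bool) (v : Fin n) (hv : v ∉ A) (b : Bool) :
    |mag A (Function.update τ v b) - mag A τ| ≤ 2 := by
  rw [mag_update A τ v hv, abs_le]
  rcases spinVal_cases b with h1 | h1 <;> rcases spinVal_cases (τ v) with h2 | h2 <;>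
    rw [h1, h2] <;> constructor <;> linarith

lemma advSign_hi (A : Finset (Fin n)) (thr : ℝ) (hthr : 0 < thr) (t : ℕ)
    (h : Fin (t+1) → (Fin n → Bool)) (b : Bool)
    (hb : thr ≤ spinVal b * mag A (h (Fin.last t))) : advSign A thr t h = !b := by
  cases b
  · simp [spinVal] at hb
    cases t with
    | zero =>
      have : ¬ thr ≤ mag A (h 0) := by
        intro h'; simp at hb; linarith
      simp [advSign, this]
    | succ t =>
      have h1 : ¬ thr ≤ mag A (h (Fin.last (t+1))) := by
        intro h'; linarith
      have h2 : mag A (h (Fin.last (t+1))) ≤ -thr := by linarith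
      simp [advSign, h1, h2]
  · simp [spinVal] at hb
    cases t with
    | zero =>
      have : thr ≤ mag A (h 0) := by simpa using hb
      simp [advSign, this]
    | succ t => simp [advSign, hb]

lemma inv_next (A : Finset (Fin n)) (thr m : ℝ) (hthr : 0 < thr) (hm : thr + 2 ≤ m / 2) (t : ℕ)
    (h : Fin (t+1) → (Fin n → Bool)) (τ : Fin n → Bool)
    (hτ : |mag A τ - mag A (h (Fin.last t))| ≤ 2) :
    InvP A m (nxt A (advSign A thr t h) τ) := by
  intro b hb u hu
  rw [mag_nxt] at hb
  have : thr ≤ spinVal b * mag A (h (Fin.last t)) := by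
    rw [abs_le] at hτ
    rcases spinVal_cases b with h1 | h1 <;> rw [h1] at hb ⊢ <;> linarith
  simp [nxt, hu, advSign_hi A thr hthr t h b this]

lemma nbr_eq (A : Finset (Fin n)) (σ : Fin n → Bool) (v : Fin n) (c : Bool)
    (hA : ∀ u ∈ A, σ u = c) :
    nbrSumK σ v = mag A σ + A.card * spinVal c - spinVal (σ v) := by
  have h1 : nbrSumK σ v = ∑ u, spinVal (σ u) - spinVal (σ v) := by
    unfold nbrSumK
    have : ∀ u : Fin n, (if u ≠ v then spinVal (σ u) else 0)
        = spinVal (σ u) - (if u = v then spinVal (σ u) else 0) := by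
      intro u; by_cases h : u = v <;> simp [h]
    simp only [this, Finset.sum_sub_distrib]
    simp
  rw [h1, ← Finset.sum_compl_add_sum A, mag]
  have : ∑ u ∈ A, spinVal (σ u) = A.card * spinVal c := by
    rw [Finset.sum_congr rfl (fun u hu => by rw [hA u hu] : ∀ u ∈ A, spinVal (σ u) = spinVal c)]
    simp
  rw [this]

lemma one_step (A : Finset (Fin n)) (β lam m δ : ℝ) (σ : Fin n → Bool) (hn : 0 < n)
    (hβ : 0 < β) (hlam : 0 ≤ lam) (hm : 4 ≤ m) (hA : 2 * m ≤ A.card) (hA2 : (A.card : ℝ) ≤ n / 2)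
    (hδ : exp (lam * (2 - m / 2)) ≤ δ) (hδ1 : δ ≤ 1)
    (hq : exp (-(2 * β * (m - 1)) + 2 * lam) ≤ 1 / 10) (hl : exp (-(2 * lam)) ≤ 1 / 10)
    (hM : |mag A σ| ≤ m) (hI : InvP A m σ) :
    (n : ℝ)⁻¹ * ∑ v : Fin n,
      (if v ∈ A then gpot lam m (mag A σ)
      else glauberPK β σ v * gpot lam m (mag A (Function.update σ v true))
        + (1 - glauberPK β σ v) * gpot lam m (mag A (Function.update σ v false)))
      ≤ δ + (1 - δ) * gpot lam m (mag A σ) := by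
  have hn' : (0 : ℝ) < n := by exact_mod_cast hn
  have hg0 : 0 < gpot lam m (mag A σ) := exp_pos _
  have hg1 : gpot lam m (mag A σ) ≤ 1 := by
    unfold gpot; rw [exp_le_one_iff]; exact mul_nonpos_of_nonneg_of_nonpos hlam (by linarith)
  by_cases hmid : |mag A σ| ≤ m / 2
  · have hsmall : ∀ x, |x - mag A σ| ≤ 2 → gpot lam m x ≤ δ := by
      intro x hx
      refine le_trans ?_ hδ
      unfold gpot
      apply exp_le_exp.2
      apply mul_le_mul_of_nonneg_left _ hlam
      have := abs_sub_abs_le_abs_sub x (mag A σ)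
      linarith
    have : ∑ v : Fin n, (if v ∈ A then gpot lam m (mag A σ)
      else glauberPK β σ v * gpot lam m (mag A (Function.update σ v true))
        + (1 - glauberPK β σ v) * gpot lam m (mag A (Function.update σ v false))) ≤
        ∑ v : Fin n, δ := by
      refine Finset.sum_le_sum fun v _ => ?_
      split_ifs with hv
      · exact hsmall _ (by simp)
      · have h1 := hsmall _ (mag_close A σ v hv true)
        have h2 := hsmall _ (mag_close A σ v hv false)
        have h3 := glauber_nonneg β σ v
        have h4 := glauber_le_one β σ v
        nlinarith [mul_le_mul_of_nonneg_left h1 h3, mul_le_mul_of_nonneg_left h2 (sub_nonneg.2 h4)]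
    simp at this
    calc _ ≤ (n : ℝ)⁻¹ * (n * δ) := by gcongr
      _ = δ := by field_simp
      _ ≤ _ := by nlinarith
  · push Not at hmid
    obtain ⟨b, hb⟩ : ∃ b : Bool, spinVal b * mag A σ = |mag A σ| := by
      rcases abs_cases (mag A σ) with h | h
      · exact ⟨true, by simp [spinVal, h.1]⟩
      · exact ⟨false, by simp [spinVal, h.1]⟩
    have hAs := hI b (by rw [hb]; exact hmid)
    set g := gpot lam m (mag A σ) with hg
    set q := exp (-(2 * β * (m - 1))) with hqd
    have hbb : spinVal b * spinVal b = 1 := by rcases spinVal_cases b with h | h <;> rw [h] <;> norm_num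
    have hqpos : 0 < q := exp_pos _
    have hE : 1 ≤ exp (2 * lam) := by rw [one_le_exp_iff]; linarith
    rw [exp_add, ← hqd] at hq
    have hq1 : q ≤ 1 / 10 := by nlinarith
    have hw : ∀ v, glB β σ v b ≤ q := by
      intro v
      refine (glB_le β σ v b).trans ?_
      apply exp_le_exp.2
      rw [nbr_eq A σ v _ hAs, spinVal_not]
      have : spinVal b * (mag A σ + A.card * -spinVal b - spinVal (σ v)) ≤ -(m - 1) := by
        have e : spinVal b * (mag A σ + A.card * -spinVal b - spinVal (σ v))
          = |mag A σ| - A.card - spinVal b * spinVal (σ v) := by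
          rw [← hb]; linear_combination (-(A.card:ℝ)) * hbb
        rw [e]
        have : -1 ≤ spinVal b * spinVal (σ v) := by
          rcases spinVal_cases b with h | h <;> rcases spinVal_cases (σ v) with h' | h' <;>
            rw [h, h'] <;> norm_num
        linarith
      nlinarith
    have hgup : ∀ x, |x| = |mag A σ| + 2 → gpot lam m x = g * exp (2 * lam) := by
      intro x hx; rw [hg]; unfold gpot; rw [← exp_add, hx]; congr 1; ring
    have hgdn : ∀ x, |x| = |mag A σ| - 2 → gpot lam m x = g * exp (-(2 * lam)) := by
      intro x hx; rw [hg]; unfold gpot; rw [← exp_add, hx]; congr 1; ring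
    have hterm : ∀ v ∉ A, glauberPK β σ v * gpot lam m (mag A (Function.update σ v true))
        + (1 - glauberPK β σ v) * gpot lam m (mag A (Function.update σ v false)) ≤
        g * (1 + q * exp (2 * lam)) +
          (1 + spinVal b * spinVal (σ v)) / 2 * (g * (q + exp (-(2 * lam)) - 1)) := by
      intro v hv
      have hsum : glauberPK β σ v * gpot lam m (mag A (Function.update σ v true))
        + (1 - glauberPK β σ v) * gpot lam m (mag A (Function.update σ v false)) =
        glB β σ v b * gpot lam m (mag A (Function.update σ v b)) +
        (1 - glB β σ v b) * gpot lam m (mag A (Function.update σ v (!b))) := by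
        cases b <;> simp [glB]
        ring
      have hw0 : 0 ≤ glB β σ v b := by
        have h3 := glauber_nonneg β σ v
        have h4 := glauber_le_one β σ v
        unfold glB; split_ifs <;> linarith
      have hwv := hw v
      rw [hsum, mag_update A σ v hv, mag_update A σ v hv, spinVal_not]
      have hMb : mag A σ = spinVal b * |mag A σ| := by
        rw [← hb, ← mul_assoc, hbb, one_mul]
      have hcase : spinVal (σ v) = spinVal b ∨ spinVal (σ v) = - spinVal b := by
        rcases spinVal_cases b with h | h <;> rcases spinVal_cases (σ v) with h' | h' <;>
          rw [h, h'] <;> norm_num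
      have habs : |spinVal b| = 1 := by
        rcases spinVal_cases b with h | h <;> rw [h] <;> norm_num
      have e2 : 0 < exp (-(2 * lam)) := exp_pos _
      rcases hcase with h | h
      · rw [h, sub_self, add_zero, hgdn (mag A σ + (-spinVal b - spinVal b)), hbb, ← hg]
        · have a1 : glB β σ v b * g ≤ q * g := mul_le_mul_of_nonneg_right hwv hg0.le
          have a2 : 0 ≤ glB β σ v b * (g * exp (-(2*lam))) := by positivity
          have a3 : 0 ≤ g * (q * exp (2*lam)) := by positivity
          linarith
        · have : mag A σ + (-spinVal b - spinVal b) = spinVal b * (|mag A σ| - 2) := by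
            linear_combination hMb
          rw [this, abs_mul, habs, one_mul, abs_of_nonneg (by linarith)]
      · rw [h, sub_self, add_zero, hgup (mag A σ + (spinVal b - -spinVal b)), ← hg]
        · have a1 : glB β σ v b * (g * exp (2*lam)) ≤ q * (g * exp (2*lam)) :=
            mul_le_mul_of_nonneg_right hwv (by positivity)
          have a2 : 0 ≤ glB β σ v b * g := by positivity
          have : spinVal b * - spinVal b = -1 := by linarith
          rw [this]
          linarith
        · have : mag A σ + (spinVal b - -spinVal b) = spinVal b * (|mag A σ| + 2) := by
            linear_combination hMb
          rw [this, abs_mul, habs, one_mul, abs_of_nonneg (by positivity)]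
    have hcard : (Aᶜ.card : ℝ) = n - A.card := by
      rw [Finset.card_compl, Fintype.card_fin, Nat.cast_sub]
      simpa using Finset.card_le_univ A
    have hS : ∑ v : Fin n, (if v ∈ A then g
      else glauberPK β σ v * gpot lam m (mag A (Function.update σ v true))
        + (1 - glauberPK β σ v) * gpot lam m (mag A (Function.update σ v false))) ≤ n * g := by
      rw [← Finset.sum_compl_add_sum A]
      have s1 : ∑ v ∈ A, (if v ∈ A then g
        else glauberPK β σ v * gpot lam m (mag A (Function.update σ v true))
        + (1 - glauberPK β σ v) * gpot lam m (mag A (Function.update σ v false))) = A.card * g := by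
        rw [Finset.sum_congr rfl (fun v hv => if_pos hv)]; simp
      have s2 : ∑ v ∈ Aᶜ, (if v ∈ A then g
        else glauberPK β σ v * gpot lam m (mag A (Function.update σ v true))
        + (1 - glauberPK β σ v) * gpot lam m (mag A (Function.update σ v false))) ≤
          ∑ v ∈ Aᶜ, (g * (1 + q * exp (2 * lam)) +
          (1 + spinVal b * spinVal (σ v)) / 2 * (g * (q + exp (-(2 * lam)) - 1))) := by
        refine Finset.sum_le_sum fun v hv => ?_
        have hv' : v ∉ A := by simpa using hv
        rw [if_neg hv']; exact hterm v hv'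
      have s3 : ∑ v ∈ Aᶜ, (g * (1 + q * exp (2 * lam)) +
          (1 + spinVal b * spinVal (σ v)) / 2 * (g * (q + exp (-(2 * lam)) - 1))) =
          (n - A.card) * (g * (1 + q * exp (2 * lam))) +
          ((n - A.card) + |mag A σ|) / 2 * (g * (q + exp (-(2 * lam)) - 1)) := by
        have hs : ∑ v ∈ Aᶜ, (1 + spinVal b * spinVal (σ v)) / 2
            = ((n - A.card) + |mag A σ|) / 2 := by
          rw [← Finset.sum_div, Finset.sum_add_distrib, ← Finset.mul_sum, ← hb]
          simp only [Finset.sum_const, nsmul_eq_mul, hcard, mul_one]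
          rfl
        rw [Finset.sum_add_distrib, ← hs, Finset.sum_mul]
        simp only [Finset.sum_const, nsmul_eq_mul, hcard]
      rw [s1]
      rw [s3] at s2
      refine (add_le_add_left s2 _).trans ?_
      have hk : (n:ℝ) / 4 ≤ ((n - A.card) + |mag A σ|) / 2 := by
        have := abs_nonneg (mag A σ); linarith
      have u1 : ((n - A.card) + |mag A σ|) / 2 * (g * (q + exp (-(2 * lam)) - 1)) ≤
          (n:ℝ) / 4 * (g * (- (8/10))) := by
        have : g * (q + exp (-(2 * lam)) - 1) ≤ g * (-(8/10)) :=
          mul_le_mul_of_nonneg_left (by linarith) hg0.le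
        have h0 : g * (-(8/10)) ≤ 0 := by linarith
        nlinarith
      have u2 : (n - A.card : ℝ) * (g * (q * exp (2 * lam))) ≤ n * (g * (1/10)) := by
        have : g * (q * exp (2*lam)) ≤ g * (1/10) := mul_le_mul_of_nonneg_left hq hg0.le
        have hc : (0:ℝ) ≤ A.card := by positivity
        apply mul_le_mul _ this (by positivity) hn'.le
        linarith
      have u3 : 0 ≤ (n:ℝ) * g := by positivity
      nlinarith
    calc _ ≤ (n : ℝ)⁻¹ * (n * g) := by gcongr
      _ = g := by field_simp
      _ ≤ _ := by
        have hd0 : 0 ≤ δ := (exp_pos _).le.trans hδ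
        have := mul_nonneg hd0 (sub_nonneg.2 hg1)
        linarith

lemma step_F (A : Finset (Fin n)) (β lam m δ thr : ℝ) (hn : 0 < n)
    (hβ : 0 < β) (hlam : 0 ≤ lam) (hm : 4 ≤ m) (hA : 2 * m ≤ A.card) (hA2 : (A.card : ℝ) ≤ n / 2)
    (hδ : exp (lam * (2 - m / 2)) ≤ δ) (hδ1 : δ ≤ 1)
    (hq : exp (-(2 * β * (m - 1)) + 2 * lam) ≤ 1 / 10) (hl : exp (-(2 * lam)) ≤ 1 / 10)
    (hthr : 0 < thr) (hthm : thr + 2 ≤ m / 2) (t : ℕ)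
    (h : Fin (t+1) → (Fin n → Bool))
    (hM : |mag A (h (Fin.last t))| ≤ m) :
    (1 - δ) * Fpot A lam m (h (Fin.last t)) ≤
      ∑ σ', polarK β A thr t h σ' * (if |mag A σ'| ≤ m then Fpot A lam m σ' else 0) := by
  have hgood : ∀ σ' : Fin n → Bool, |mag A σ'| ≤ m → 0 ≤ Fpot A lam m σ' := by
    intro σ' hs
    unfold Fpot gpot
    split_ifs
    · rw [sub_nonneg, exp_le_one_iff]; exact mul_nonpos_of_nonneg_of_nonpos hlam (by linarith)
    · exact le_rfl
  by_cases hI : InvP A m (h (Fin.last t))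
  swap
  · have : Fpot A lam m (h (Fin.last t)) = 0 := by simp [Fpot, hI]
    rw [this, mul_zero]
    refine Finset.sum_nonneg fun σ' _ => mul_nonneg (polarK_nonneg ..) ?_
    split_ifs with hs
    · exact hgood _ hs
    · exact le_rfl
  have hbad : ∀ σ' : Fin n → Bool,
      Fpot A lam m σ' ≤ (if |mag A σ'| ≤ m then Fpot A lam m σ' else 0) := by
    intro σ'
    split_ifs with hs
    · exact le_rfl
    · push Not at hs
      unfold Fpot gpot
      split_ifs
      · rw [sub_nonpos, one_le_exp_iff]; exact mul_nonneg hlam (by linarith)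
      · exact le_rfl
  refine le_trans ?_ (Finset.sum_le_sum fun σ' _ =>
    mul_le_mul_of_nonneg_left (hbad σ') (polarK_nonneg β A thr t h σ'))
  rw [step_sum]
  have h1 := one_step A β lam m δ (h (Fin.last t)) hn hβ hlam hm hA hA2 hδ hδ1 hq hl hM hI
  have hn' : (0 : ℝ) < n := by exact_mod_cast hn
  have e : ∀ v : Fin n, (if v ∈ A then Fpot A lam m (nxt A (advSign A thr t h) (h (Fin.last t)))
      else glauberPK β (h (Fin.last t)) v *
          Fpot A lam m (nxt A (advSign A thr t h) (Function.update (h (Fin.last t)) v true))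
        + (1 - glauberPK β (h (Fin.last t)) v) *
          Fpot A lam m (nxt A (advSign A thr t h) (Function.update (h (Fin.last t)) v false))) =
      1 - (if v ∈ A then gpot lam m (mag A (h (Fin.last t)))
      else glauberPK β (h (Fin.last t)) v * gpot lam m (mag A (Function.update (h (Fin.last t)) v true))
        + (1 - glauberPK β (h (Fin.last t)) v) *
          gpot lam m (mag A (Function.update (h (Fin.last t)) v false))) := by
    intro v
    split_ifs with hv
    · unfold Fpot
      rw [if_pos (inv_next A thr m hthr hthm t h _ (by simp)), mag_nxt]
    · unfold Fpot
      rw [if_pos (inv_next A thr m hthr hthm t h _ (mag_close A _ v hv true)),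
        if_pos (inv_next A thr m hthr hthm t h _ (mag_close A _ v hv false)), mag_nxt, mag_nxt]
      ring
  simp only [e, Finset.sum_sub_distrib, mul_sub]
  have : (n:ℝ)⁻¹ * ∑ v : Fin n, (1:ℝ) = 1 := by simp; field_simp
  rw [this]
  unfold Fpot
  rw [if_pos hI]
  linarith

lemma trajD_nonneg (A : Finset (Fin n)) (β thr : ℝ) (t : ℕ) (h : Fin (t+1) → (Fin n → Bool)) :
    0 ≤ trajD (initIID A) (polarK β A thr) t h := by
  induction t with
  | zero => simp only [trajD, initIID]; split_ifs <;> positivity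
  | succ t ih => exact mul_nonneg (ih _) (polarK_nonneg ..)

lemma sum_snoc {α : Type*} [Fintype α] (t : ℕ) (f : (Fin (t+1+1) → α) → ℝ) :
    ∑ h, f h = ∑ h : Fin (t+1) → α, ∑ x : α, f (Fin.snoc h x) := by
  rw [← Fintype.sum_equiv (Fin.snocEquiv (fun _ => α)) (fun p => f (Fin.snoc p.2 p.1)) f
    (fun p => rfl), Fintype.sum_prod_type, Finset.sum_comm]

lemma traj_bound (A : Finset (Fin n)) (β lam m δ thr : ℝ) (hn : 0 < n)
    (hβ : 0 < β) (hlam : 0 ≤ lam) (hm : 4 ≤ m) (hA : 2 * m ≤ A.card) (hA2 : (A.card : ℝ) ≤ n / 2)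
    (hδ : exp (lam * (2 - m / 2)) ≤ δ) (hδ1 : δ ≤ 1)
    (hq : exp (-(2 * β * (m - 1)) + 2 * lam) ≤ 1 / 10) (hl : exp (-(2 * lam)) ≤ 1 / 10)
    (hthr : 0 < thr) (hthm : thr + 2 ≤ m / 2) (T : ℕ) :
    (∑ σ, if |mag A σ| ≤ m then initIID A σ * Fpot A lam m σ else 0) * (1 - δ) ^ T ≤
      ∑ h : Fin (T+1) → (Fin n → Bool), if (∀ i, |mag A (h i)| ≤ m) then
        trajD (initIID A) (polarK β A thr) T h * Fpot A lam m (h (Fin.last T)) else 0 := by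
  induction T with
  | zero =>
    rw [pow_zero, mul_one]
    apply le_of_eq
    refine Fintype.sum_equiv (Equiv.funUnique (Fin 1) (Fin n → Bool)).symm _ _ fun σ => ?_
    simp [trajD, Equiv.funUnique]
  | succ T ih =>
    rw [pow_succ, ← mul_assoc]
    refine (mul_le_mul_of_nonneg_right ih (by linarith)).trans ?_
    rw [sum_snoc, Finset.sum_mul]
    refine Finset.sum_le_sum fun h _ => ?_
    by_cases hg : ∀ i, |mag A (h i)| ≤ m
    · rw [if_pos hg]
      have hs := step_F A β lam m δ thr hn hβ hlam hm hA hA2 hδ hδ1 hq hl hthr hthm T h (hg _)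
      have := mul_le_mul_of_nonneg_left hs (trajD_nonneg A β thr T h)
      refine le_trans (le_of_eq (by ring)) (this.trans (le_of_eq ?_))
      rw [Finset.mul_sum]
      refine Finset.sum_congr rfl fun x _ => ?_
      have hx : (∀ i : Fin (T+1+1), |mag A ((Fin.snoc h x : Fin (T+1+1) → (Fin n → Bool)) i)| ≤ m)
          ↔ |mag A x| ≤ m := by
        constructor
        · intro h'; simpa using h' (Fin.last _)
        · intro h' i
          refine Fin.lastCases ?_ (fun j => ?_) i
          · simpa using h'
          · simpa using hg j
      simp only [hx]
      split_ifs
      · simp [trajD, mul_assoc]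
      · simp
    · rw [if_neg hg, zero_mul]
      refine Finset.sum_nonneg fun x _ => ?_
      rw [if_neg]
      intro h'
      exact hg fun i => by simpa using h' i.castSucc

lemma init_mgf (A : Finset (Fin n)) (θ : ℝ) :
    ∑ σ, initIID A σ * exp (θ * mag A σ) = cosh θ ^ (n - A.card) := by
  have h1 : ∀ σ : Fin n → Bool, initIID A σ * exp (θ * mag A σ) =
      ∏ v, (if v ∈ A then (if σ v = true then (1:ℝ) else 0) else 1/2 * exp (θ * spinVal (σ v))) := by
    intro σ
    rw [← Finset.prod_compl_mul_prod A]
    have p1 : ∏ v ∈ A, (if v ∈ A then (if σ v = true then (1:ℝ) else 0)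
        else 1/2 * exp (θ * spinVal (σ v))) = if (∀ v ∈ A, σ v = true) then 1 else 0 := by
      rw [Finset.prod_congr rfl (fun v hv => if_pos hv), Finset.prod_ite_zero]
      simp
    have p2 : ∏ v ∈ Aᶜ, (if v ∈ A then (if σ v = true then (1:ℝ) else 0)
        else 1/2 * exp (θ * spinVal (σ v))) = (1/2)^(n - A.card) * exp (θ * mag A σ) := by
      rw [Finset.prod_congr rfl (fun v hv => if_neg (by simpa using hv)), Finset.prod_mul_distrib,
        ← exp_sum, mag, Finset.mul_sum]
      simp [Finset.card_compl]
    rw [p1, p2, initIID]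
    split_ifs <;> simp
  simp only [h1]
  have h2 := Finset.prod_univ_sum (fun _ : Fin n => (Finset.univ : Finset Bool))
    (fun v b => (if v ∈ A then (if b = true then (1:ℝ) else 0) else 1/2 * exp (θ * spinVal b)))
  rw [Fintype.piFinset_univ] at h2
  rw [← h2]
  have h3 : ∀ v : Fin n, ∑ b : Bool,
      (if v ∈ A then (if b = true then (1:ℝ) else 0) else 1/2 * exp (θ * spinVal b)) =
      if v ∈ A then 1 else cosh θ := by
    intro v
    split_ifs
    · simp
    · simp [spinVal, cosh_eq]; ring
  simp only [h3]
  rw [← Finset.prod_compl_mul_prod A, Finset.prod_congr rfl (fun v hv => if_neg (by simpa using hv)),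
    Finset.prod_congr rfl (fun v hv => if_pos hv)]
  simp [Finset.card_compl]

lemma init_bound (A : Finset (Fin n)) (lam m : ℝ) (hn : 0 < n) (hlam : 0 ≤ lam) (hm : 0 ≤ m) :
    1 - exp (-(lam * (m / 2))) - 2 * exp (-(m ^ 2 / (8 * n))) ≤
    ∑ σ, if |mag A σ| ≤ m then initIID A σ * Fpot A lam m σ else 0 := by
  have hn' : (0 : ℝ) < n := by exact_mod_cast hn
  set θ : ℝ := m / (2 * n) with hθ
  have hθ0 : 0 ≤ θ := by positivity
  have hpt : ∀ σ : Fin n → Bool, initIID A σ * (1 - exp (-(lam * (m / 2)))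
      - exp (-(θ * (m/2))) * exp (θ * mag A σ) - exp (-(θ * (m/2))) * exp (-θ * mag A σ)) ≤
      if |mag A σ| ≤ m then initIID A σ * Fpot A lam m σ else 0 := by
    intro σ
    have hi : 0 ≤ initIID A σ := by unfold initIID; split_ifs <;> positivity
    have : (1 - exp (-(lam * (m / 2)))
      - exp (-(θ * (m/2))) * exp (θ * mag A σ) - exp (-(θ * (m/2))) * exp (-θ * mag A σ)) ≤
      if |mag A σ| ≤ m then Fpot A lam m σ else 0 := by
      have e0 := exp_pos (-(lam * (m / 2)))
      have e1 : 0 < exp (-(θ * (m/2))) * exp (θ * mag A σ) := by positivity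
      have e2 : 0 < exp (-(θ * (m/2))) * exp (-θ * mag A σ) := by positivity
      by_cases hs : |mag A σ| ≤ m / 2
      · rw [if_pos (by linarith), Fpot, if_pos]
        · have : gpot lam m (mag A σ) ≤ exp (-(lam * (m/2))) := by
            unfold gpot; apply exp_le_exp.2; nlinarith
          linarith
        · intro b hb
          exfalso
          have := abs_le.1 hs
          rcases spinVal_cases b with h | h <;> rw [h] at hb <;> linarith
      · have hr : 0 ≤ if |mag A σ| ≤ m then Fpot A lam m σ else 0 := by
          split_ifs with h
          · unfold Fpot gpot
            split_ifs
            · rw [sub_nonneg, exp_le_one_iff]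
              exact mul_nonpos_of_nonneg_of_nonpos hlam (by linarith)
            · exact le_rfl
          · exact le_rfl
        refine le_trans ?_ hr
        push Not at hs
        rcases lt_abs.1 hs with h | h
        · have : 1 ≤ exp (-(θ * (m/2))) * exp (θ * mag A σ) := by
            rw [← exp_add, one_le_exp_iff]; nlinarith
          linarith
        · have : 1 ≤ exp (-(θ * (m/2))) * exp (-θ * mag A σ) := by
            rw [← exp_add, one_le_exp_iff]; nlinarith
          linarith
    have := mul_le_mul_of_nonneg_left this hi
    refine this.trans (le_of_eq ?_)
    split_ifs <;> simp
  refine le_trans ?_ (Finset.sum_le_sum fun σ _ => hpt σ)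
  have h1 := init_mgf A θ
  have h2 := init_mgf A (-θ)
  have h0 := init_mgf A 0
  simp at h0
  have e : ∑ σ, initIID A σ * (1 - exp (-(lam * (m / 2)))
      - exp (-(θ * (m/2))) * exp (θ * mag A σ) - exp (-(θ * (m/2))) * exp (-θ * mag A σ)) =
      (∑ σ, initIID A σ) * (1 - exp (-(lam * (m/2))))
       - exp (-(θ * (m/2))) * (∑ σ, initIID A σ * exp (θ * mag A σ))
       - exp (-(θ * (m/2))) * (∑ σ, initIID A σ * exp (-θ * mag A σ)) := by
    rw [Finset.sum_mul, Finset.mul_sum, Finset.mul_sum, ← Finset.sum_sub_distrib,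
      ← Finset.sum_sub_distrib]
    exact Finset.sum_congr rfl fun σ _ => by ring
  rw [e, h0, h1, h2, cosh_neg]
  have hc : exp (-(θ * (m/2))) * cosh θ ^ (n - A.card) ≤ exp (-(m ^ 2 / (8 * n))) := by
    have c1 : cosh θ ^ (n - A.card) ≤ exp (n * (θ ^ 2 / 2)) := by
      calc cosh θ ^ (n - A.card) ≤ cosh θ ^ n :=
            pow_le_pow_right₀ (one_le_cosh θ) (Nat.sub_le _ _)
        _ ≤ (exp (θ ^ 2 / 2)) ^ n :=
            pow_le_pow_left₀ (cosh_pos θ).le (cosh_le_exp_half_sq θ) n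
        _ = _ := by rw [← exp_nat_mul]
    refine (mul_le_mul_of_nonneg_left c1 (exp_pos _).le).trans ?_
    rw [← exp_add]
    apply exp_le_exp.2
    apply le_of_eq
    rw [hθ]
    field_simp
    ring
  linarith

lemma asymp (ε β : ℝ) (hε0 : 0 < ε) (hε : ε < 1/2) (hβ : 0 < β) :
    ∃ n₀ : ℕ, ∀ n : ℕ, n₀ ≤ n → 0 < n ∧ 1 ≤ β * n ∧ 1000 ≤ (n:ℝ) ^ (ε/2) ∧
      20 ≤ β * (n:ℝ) ^ ((1:ℝ)/2 + ε) - 4 * β ∧ 32 ≤ (n:ℝ) ^ ((1:ℝ)/2 + ε) ∧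
      4 ≤ (n:ℝ) ^ ((1:ℝ)/2 - ε) ∧ (4:ℝ) ≤ n := by
  have ht : ∀ a : ℝ, 0 < a → Filter.Tendsto (fun n : ℕ => (n:ℝ) ^ a) Filter.atTop Filter.atTop :=
    fun a ha => (tendsto_rpow_atTop ha).comp tendsto_natCast_atTop_atTop
  have h1 := (ht (ε/2) (by linarith)).eventually_ge_atTop 1000
  have h2 := (ht (1/2+ε) (by linarith)).eventually_ge_atTop ((20 + 4 * β) / β)
  have h3 := (ht (1/2+ε) (by linarith)).eventually_ge_atTop 32
  have h4 := (ht (1/2-ε) (by linarith)).eventually_ge_atTop 4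
  have h5 := (tendsto_natCast_atTop_atTop (R := ℝ)).eventually_ge_atTop (1/β)
  have h6 := (tendsto_natCast_atTop_atTop (R := ℝ)).eventually_ge_atTop 4
  have := ((((h1.and h2).and h3).and h4).and h5).and h6
  rw [Filter.eventually_atTop] at this
  obtain ⟨N, hN⟩ := this
  refine ⟨N, fun n hn => ?_⟩
  obtain ⟨⟨⟨⟨⟨a1, a2⟩, a3⟩, a4⟩, a5⟩, a6⟩ := hN n hn
  rw [div_le_iff₀ hβ] at a2 a5
  refine ⟨?_, by linarith, a1, by linarith, a3, a4, a6⟩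
  have : (0:ℝ) < n := by linarith
  exact_mod_cast this

/-- **Efficient polarization on the complete graph.** Fix `ε ∈ (0,1/2)` and `β > 0`.
For all sufficiently large `n`, with `|A| = ⌈n^{1/2+ε}⌉` corrupted vertices and the
threshold-switching adversary with threshold `n^{1/2+ε/2}`, starting from i.i.d. uniform
spins off `A`, for every `T` the probability that the uncorrupted magnetization
satisfies `|M_t| ≤ (1/2)n^{1/2+ε}` for all `t ≤ T` is at least
`(1 − e^{−n^ε/2})·(1 − e^{−βn})^T`. -/
theorem mean_field_polarization (ε β : ℝ) (hε0 : 0 < ε) (hε : ε < 1/2) (hβ : 0 < β) :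
    ∃ n₀ : ℕ, ∀ n : ℕ, n₀ ≤ n →
      ∀ A : Finset (Fin n), A.card = ⌈(n : ℝ) ^ ((1:ℝ)/2 + ε)⌉₊ →
      ∀ T : ℕ,
        (1 - exp (-((n : ℝ) ^ ε) / 2)) * (1 - exp (-β * n)) ^ T ≤
          ∑ h : Fin (T+1) → (Fin n → Bool),
            if (∀ i, |mag A (h i)| ≤ (1/2) * (n : ℝ) ^ ((1:ℝ)/2 + ε))
            then trajD (initIID A) (polarK β A ((n : ℝ) ^ ((1:ℝ)/2 + ε/2))) T h
            else 0 := by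
  obtain ⟨n₀, hn₀⟩ := asymp ε β hε0 hε hβ
  refine ⟨n₀, fun n hn A hA T => ?_⟩
  obtain ⟨hpos, a1, a2, a3, a4, a5, a6⟩ := hn₀ n hn
  have hn' : (0:ℝ) < n := by exact_mod_cast hpos
  set L := (n:ℝ) ^ ((1:ℝ)/2 + ε) with hL
  set thr := (n:ℝ) ^ ((1:ℝ)/2 + ε/2) with hthr
  set Y := (n:ℝ) ^ (ε/2) with hY
  have hX : (n:ℝ) ^ ε = Y ^ 2 := by
    rw [hY, ← rpow_natCast, ← rpow_mul hn'.le]; congr 1; push_cast; ring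
  have hLY : L = thr * Y := by
    rw [hL, hthr, hY, ← rpow_add hn']; congr 1; ring
  have hL2 : L ^ 2 = n * Y ^ 4 := by
    have : (n:ℝ) * Y ^ 4 = (n:ℝ) ^ (1:ℝ) * (n:ℝ) ^ (ε/2 * (4:ℕ)) := by
      rw [rpow_one, rpow_mul hn'.le, rpow_natCast]
    rw [this, hL, ← rpow_natCast, ← rpow_mul hn'.le, ← rpow_add hn']; congr 1; push_cast; ring
  have hLn : L * (n:ℝ) ^ ((1:ℝ)/2 - ε) = n := by
    rw [hL, ← rpow_add hn']; norm_num
  have hthr0 : 0 < thr := rpow_pos_of_pos hn' _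
  have hL0 : 0 < L := by linarith
  have hA1 : L ≤ A.card := by rw [hA]; exact Nat.le_ceil _
  have hA2 : (A.card : ℝ) ≤ n / 2 := by
    have : (A.card : ℝ) < L + 1 := by rw [hA]; exact Nat.ceil_lt_add_one hL0.le
    nlinarith
  have hexp10 : ∀ x : ℝ, x ≤ -10 → exp x ≤ 1 / 10 := by
    intro x hx
    rw [show x = -(-x) by ring, exp_neg, one_div]
    apply inv_anti₀ (by norm_num)
    linarith [add_one_le_exp (-x)]
  have hY2 : 1000000 ≤ Y ^ 2 := by nlinarith
  have hY4 : 1000000 * Y ^ 2 ≤ Y ^ 4 := by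
    calc 1000000 * Y ^ 2 ≤ Y ^ 2 * Y ^ 2 := mul_le_mul_of_nonneg_right hY2 (by positivity)
      _ = Y ^ 4 := by ring
  have hβL : β * n * Y ^ 4 = β * L ^ 2 := by rw [hL2]; ring
  have hβ4 : β * n * Y ^ 2 ≤ β * n * Y ^ 4 := by
    apply mul_le_mul_of_nonneg_left _ (by positivity); linarith
  have hδ : exp ((β * L / 4) * (2 - (1/2 * L) / 2)) ≤ exp (-β * n) := by
    apply exp_le_exp.2
    have : β * n * 1000000 ≤ β * L ^ 2 := by
      rw [← hβL]; apply mul_le_mul_of_nonneg_left _ (by positivity); linarith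
    have : β * L * 16 ≤ β * L ^ 2 := by
      rw [pow_two, ← mul_assoc]; apply mul_le_mul_of_nonneg_left _ (by positivity); linarith
    nlinarith
  have hδ1 : exp (-β * n) ≤ 1 := by rw [exp_le_one_iff]; nlinarith
  have hthL : thr * 1000 ≤ L := by rw [hLY]; exact mul_le_mul_of_nonneg_left a2 hthr0.le
  have hb := traj_bound A β (β * L / 4) (1/2 * L) (exp (-β * n)) thr hpos hβ (by positivity)
    (by linarith) (by linarith) hA2 hδ hδ1 (hexp10 _ (by linarith)) (hexp10 _ (by linarith))
    hthr0 (by linarith) T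
  have hi := init_bound A (β * L / 4) (1/2 * L) hpos (by positivity) (by positivity)
  have hi2 : 1 - exp (-((n:ℝ) ^ ε) / 2) ≤
      1 - exp (-(β * L / 4 * (1/2 * L / 2))) - 2 * exp (-((1/2 * L) ^ 2 / (8 * n))) := by
    have t1 : exp (-(β * L / 4 * (1/2 * L / 2))) ≤ exp (-((n:ℝ) ^ ε) / 2) * (1 / 10) := by
      rw [hX]
      refine le_trans ?_ (mul_le_mul_of_nonneg_left (hexp10 (-(Y^2)) (by linarith)) (exp_pos _).le) 
      rw [← exp_add]
      apply exp_le_exp.2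
      have : 1 * Y ^ 4 ≤ β * n * Y ^ 4 := mul_le_mul_of_nonneg_right a1 (by positivity)
      have e : β * L / 4 * (1/2 * L / 2) = β * L ^ 2 / 16 := by ring
      rw [e]
      linarith
    have t2 : exp (-((1/2 * L) ^ 2 / (8 * n))) ≤ exp (-((n:ℝ) ^ ε) / 2) * (1 / 10) := by
      rw [hX]
      refine le_trans ?_ (mul_le_mul_of_nonneg_left (hexp10 (-(Y^2)) (by linarith)) (exp_pos _).le) 
      rw [← exp_add]
      apply exp_le_exp.2
      have : (1/2 * L) ^ 2 / (8 * n) = Y ^ 4 / 32 := by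
        rw [mul_pow, hL2]; field_simp; norm_num
      rw [this]
      linarith
    have := exp_pos (-((n:ℝ) ^ ε) / 2)
    linarith
  refine (mul_le_mul_of_nonneg_right (hi2.trans hi) (pow_nonneg (by linarith) T)).trans
    (hb.trans ?_)
  refine Finset.sum_le_sum fun h _ => ?_
  split_ifs with hg
  · have h0 := trajD_nonneg A β thr T h
    have : Fpot A (β * L / 4) (1/2 * L) (h (Fin.last T)) ≤ 1 := by
      unfold Fpot gpot
      split_ifs
      · linarith [exp_pos (β * L / 4 * (|mag A (h (Fin.last T))| - 1/2 * L))]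
      · exact zero_le_one
    exact mul_le_of_le_one_right h0 this
  · exact le_rfl

end
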